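/- arXiv:1611.01335 — 2 statements merged into one kernel-verified Lean document; each statement's English description precedes it below -/
import Mathlib

section
/- Tensorization of Φ-ribbons: let Φ be a function in the class 𝓕, and let (X_1, …, X_k) and (Y_1, …, Y_k) be tuples of random variables taking values in finite sets such that (X_1, …, X_k) is independent of (Y_1, …, Y_k). Then 𝓡_Φ(X_1Y_1, X_2Y_2, …, X_kY_k) = 𝓡_Φ(X_1, …, X_k) ∩ 𝓡_Φ(Y_1, …, Y_k), where X_iY_i denotes the pair (X_i, Y_i) regarded as a single random variable. -/
open Finset

noncomputable section

/-- A probability mass function on a finite type. -/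
def IsPMF {Ω : Type*} [Fintype Ω] (p : Ω → ℝ) : Prop :=
  (∀ ω, 0 ≤ p ω) ∧ ∑ ω, p ω = 1

/-- Expectation of `f` under the pmf `p`. -/
def expect {Ω : Type*} [Fintype Ω] (p : Ω → ℝ) (f : Ω → ℝ) : ℝ :=
  ∑ ω, p ω * f ω

/-- Variance of `f` under the pmf `p`. -/
def var {Ω : Type*} [Fintype Ω] (p : Ω → ℝ) (f : Ω → ℝ) : ℝ :=
  ∑ ω, p ω * (f ω - expect p f) ^ 2

open scoped Classical in
/-- Conditional expectation `E[f | X]`, as a function on the sample space. -/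
def condExp {Ω β : Type*} [Fintype Ω] (p : Ω → ℝ) (f : Ω → ℝ) (X : Ω → β) : Ω → ℝ :=
  fun ω => (∑ ω', if X ω' = X ω then p ω' * f ω' else 0) /
    (∑ ω', if X ω' = X ω then p ω' else 0)

/-- The Φ-entropy `H_Φ(f) = E[Φ(f)] - Φ(E[f])`. -/
def Hphi {Ω : Type*} [Fintype Ω] (Φ : ℝ → ℝ) (p : Ω → ℝ) (f : Ω → ℝ) : ℝ :=
  expect p (fun ω => Φ (f ω)) - Φ (expect p f)

/-- The conditional Φ-entropy `H_Φ(f | X) = E[Φ(f)] - E[Φ(E[f|X])]`. -/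
def HphiCond {Ω β : Type*} [Fintype Ω] (Φ : ℝ → ℝ) (p : Ω → ℝ) (f : Ω → ℝ) (X : Ω → β) : ℝ :=
  expect p (fun ω => Φ (f ω)) - expect p (fun ω => Φ (condExp p f X ω))

/-- The class 𝓕 of smooth convex non-affine functions `Φ` on a convex domain `D ⊆ ℝ`
such that for every `q ∈ [0,1]` the map
`(s,t) ↦ q Φ(s) + (1-q) Φ(t) - Φ(q s + (1-q) t)` is jointly convex. -/
structure ClassF where
  D : Set ℝ
  Φ : ℝ → ℝ
  convex_dom : Convex ℝ D
  smooth : ContDiffOn ℝ (⊤ : ℕ∞) Φ D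
  convexOn : ConvexOn ℝ D Φ
  not_affine : ¬ ∃ a b : ℝ, ∀ t ∈ D, Φ t = a * t + b
  joint_convex : ∀ q ∈ Set.Icc (0:ℝ) 1,
    ConvexOn ℝ (D ×ˢ D)
      (fun st : ℝ × ℝ => q * Φ st.1 + (1 - q) * Φ st.2 - Φ (q * st.1 + (1 - q) * st.2))

/-- The Φ-ribbon of `k` random variables with joint pmf `p` (the `i`-th variable being the
`i`-th coordinate): all tuples `λ` of non-negative reals such that
`H_Φ(f) ≥ Σ_i λ_i H_Φ(E[f | X_i])` for every `f` with range in `D`. -/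
def ribbon {k : ℕ} {α : Fin k → Type} [∀ i, Fintype (α i)]
    (Φ : ℝ → ℝ) (D : Set ℝ) (p : (∀ i, α i) → ℝ) : Set (Fin k → ℝ) :=
  {l | (∀ i, 0 ≤ l i) ∧ ∀ f : (∀ i, α i) → ℝ, (∀ ω, f ω ∈ D) →
    Hphi Φ p f ≥ ∑ i, l i * Hphi Φ p (condExp p f (fun ω => ω i))}
/-- Transition weights of the conditional expectation given `X`, see `condExp_eq_sum_condKernel`. -/
def condKernel {Ω β : Type*} [Fintype Ω] (p : Ω → ℝ) (X : Ω → β) (ω ω' : Ω) : ℝ :=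
  open scoped Classical in
  (if X ω' = X ω then p ω' else 0) / ∑ ω'', if X ω'' = X ω then p ω'' else 0

/-- `K` is a Markov kernel (off a `p`-null set) with stationary distribution `p`. -/
structure IsStationaryKernel {Ω : Type*} [Fintype Ω] (p : Ω → ℝ) (K : Ω → Ω → ℝ) : Prop where
  nonneg : ∀ ω ω', 0 ≤ K ω ω'
  sum_eq_one : ∀ ω, p ω ≠ 0 → ∑ ω', K ω ω' = 1
  stationary : ∀ ω', ∑ ω, p ω * K ω ω' = p ω'

theorem condExp_eq_sum_condKernel {Ω β : Type*} [Fintype Ω] (p f : Ω → ℝ) (X : Ω → β) (ω : Ω) :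
    condExp p f X ω = ∑ ω', condKernel p X ω ω' * f ω' := by
  classical
  simp only [condExp, condKernel, Finset.sum_div]
  refine Finset.sum_congr rfl fun ω' _ => ?_
  split_ifs
  · ring
  · simp

theorem isStationaryKernel_condKernel {Ω β : Type*} [Fintype Ω] {p : Ω → ℝ}
    (hp : ∀ ω, 0 ≤ p ω) (X : Ω → β) : IsStationaryKernel p (condKernel p X) := by
  classical
  have hterm : ∀ ω ω', 0 ≤ (if X ω' = X ω then p ω' else 0) := fun ω ω' => by
    split_ifs <;> simp [hp]
  have hsum : ∀ ω, p ω ≠ 0 → (∑ ω', if X ω' = X ω then p ω' else 0) ≠ 0 := fun ω h => by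
    have h1 := Finset.single_le_sum (fun ω' _ => hterm ω ω') (Finset.mem_univ ω)
    rw [if_pos rfl] at h1
    exact ((lt_of_le_of_ne (hp ω) h.symm).trans_le h1).ne'
  refine ⟨fun ω ω' => div_nonneg (hterm _ _) (Finset.sum_nonneg fun _ _ => hterm _ _), ?_, ?_⟩
  · intro ω h
    simp only [condKernel]
    rw [← Finset.sum_div, div_self]
    exact hsum ω h
  · intro ω'
    by_cases h : p ω' = 0
    · simp [condKernel, h]
    · have h1 : ∀ ω, p ω * condKernel p X ω ω' = (if X ω = X ω' then p ω else 0) *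
          (p ω' / ∑ ω'', if X ω'' = X ω' then p ω'' else 0) := fun ω => by
        simp only [condKernel]
        by_cases hX : X ω = X ω'
        · simp only [hX, if_true]
        · simp [hX, Ne.symm hX]
      simp only [h1]
      rw [← Finset.sum_mul, mul_div_cancel₀ _ (hsum ω' h)]

theorem Hphi_congr {Ω : Type*} [Fintype Ω] (Φ : ℝ → ℝ) {p f g : Ω → ℝ}
    (h : ∀ ω, p ω ≠ 0 → f ω = g ω) : Hphi Φ p f = Hphi Φ p g := by
  have key : ∀ G : ℝ → ℝ, ∑ ω, p ω * G (f ω) = ∑ ω, p ω * G (g ω) := fun G =>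
    Finset.sum_congr rfl fun ω _ => by
      by_cases hω : p ω = 0
      · simp [hω]
      · rw [h ω hω]
  have h1 := key Φ
  have h2 := key id
  simp only [id] at h2
  simp only [Hphi, _root_.expect, h1, h2]

theorem Hphi_comp_equiv {Ω Ω' : Type*} [Fintype Ω] [Fintype Ω'] (Φ : ℝ → ℝ) (e : Ω ≃ Ω')
    (p f : Ω' → ℝ) : Hphi Φ (fun ω => p (e ω)) (fun ω => f (e ω)) = Hphi Φ p f := by
  simp only [Hphi, _root_.expect]
  rw [e.sum_comp (fun ω => p ω * Φ (f ω)), e.sum_comp (fun ω => p ω * f ω)]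

theorem expect_prod {A B : Type*} [Fintype A] [Fintype B] (p : A → ℝ) (q : B → ℝ)
    (f : A × B → ℝ) : expect (fun z : A × B => p z.1 * q z.2) f =
      expect q fun y => expect p fun x => f (x, y) := by
  simp only [_root_.expect, Fintype.sum_prod_type_right, Finset.mul_sum]
  exact Finset.sum_congr rfl fun y _ => Finset.sum_congr rfl fun x _ => by ring

/-- Chain rule for the `Φ`-entropy of a function of two independent variables. -/
theorem Hphi_prod {A B : Type*} [Fintype A] [Fintype B] (Φ : ℝ → ℝ) (p : A → ℝ) (q : B → ℝ)
    (f : A × B → ℝ) : Hphi Φ (fun z : A × B => p z.1 * q z.2) f =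
      expect q (fun y => Hphi Φ p fun x => f (x, y)) +
        Hphi Φ q (fun y => expect p fun x => f (x, y)) := by
  simp only [Hphi, expect_prod]
  simp only [_root_.expect, mul_sub, Finset.sum_sub_distrib]
  ring

theorem Hphi_prod_fst {A B : Type*} [Fintype A] [Fintype B] (Φ : ℝ → ℝ) {p : A → ℝ} {q : B → ℝ}
    (hq : ∑ y, q y = 1) (u : A → ℝ) :
    Hphi Φ (fun z : A × B => p z.1 * q z.2) (fun z => u z.1) = Hphi Φ p u := by
  simp only [Hphi, expect_prod]
  simp [_root_.expect, ← Finset.sum_mul, hq]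

theorem Hphi_prod_snd {A B : Type*} [Fintype A] [Fintype B] (Φ : ℝ → ℝ) {p : A → ℝ} {q : B → ℝ}
    (hp : ∑ x, p x = 1) (v : B → ℝ) :
    Hphi Φ (fun z : A × B => p z.1 * q z.2) (fun z => v z.2) = Hphi Φ q v := by
  simp only [Hphi, expect_prod]
  simp [_root_.expect, ← Finset.sum_mul, hp]

/-- Joint convexity of the binary gap of `Φ` gives convexity of the `Φ`-entropy for every finitely
supported distribution. -/
theorem ClassF.convexOn_entropy (F : ClassF) {ι : Type*} (s : Finset ι) :
    ∀ w : ι → ℝ, (∀ i ∈ s, 0 ≤ w i) → ∑ i ∈ s, w i = 1 →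
      ConvexOn ℝ {f : ι → ℝ | ∀ i ∈ s, f i ∈ F.D}
        (fun f => ∑ i ∈ s, w i * F.Φ (f i) - F.Φ (∑ i ∈ s, w i * f i)) := by
  classical
  have hconv : ∀ s : Finset ι, Convex ℝ {f : ι → ℝ | ∀ i ∈ s, f i ∈ F.D} :=
    fun s f hf g hg a b ha hb hab i hi => F.convex_dom (hf i hi) (hg i hi) ha hb hab
  induction s using Finset.induction_on with
  | empty => intro w _ h; simp at h
  | insert j s hj ih =>
    intro w hw hsum
    have hws : ∀ i ∈ s, 0 ≤ w i := fun i hi => hw i (Finset.mem_insert_of_mem hi)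
    have hwj : 0 ≤ w j := hw j (Finset.mem_insert_self _ _)
    rw [Finset.sum_insert hj] at hsum
    simp only [Finset.sum_insert hj]
    refine ⟨hconv _, fun f hf g hg a b ha hb hab => ?_⟩
    have hfs : ∀ i ∈ s, f i ∈ F.D := fun i hi => hf i (Finset.mem_insert_of_mem hi)
    have hgs : ∀ i ∈ s, g i ∈ F.D := fun i hi => hg i (Finset.mem_insert_of_mem hi)
    have hfj : f j ∈ F.D := hf j (Finset.mem_insert_self _ _)
    have hgj : g j ∈ F.D := hg j (Finset.mem_insert_self _ _)
    simp only [Pi.add_apply, Pi.smul_apply, smul_eq_mul]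
    by_cases hr : ∑ i ∈ s, w i = 0
    · have hz : ∀ i ∈ s, w i = 0 := (Finset.sum_eq_zero_iff_of_nonneg hws).1 hr
      have hj1 : w j = 1 := by linarith
      have hzero : ∀ h : ι → ℝ, ∑ i ∈ s, w i * h i = 0 := fun h =>
        Finset.sum_eq_zero fun i hi => by rw [hz i hi, zero_mul]
      rw [hzero (fun i => F.Φ (a * f i + b * g i)), hzero (fun i => a * f i + b * g i),
        hzero (fun i => F.Φ (f i)), hzero f, hzero (fun i => F.Φ (g i)), hzero g, hj1]
      simp
    · set r := ∑ i ∈ s, w i with hrdef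
      have hr0 : 0 < r := lt_of_le_of_ne (Finset.sum_nonneg hws) (Ne.symm hr)
      have hscale : ∀ h : ι → ℝ, ∑ i ∈ s, w i * h i = r * ∑ i ∈ s, w i / r * h i := fun h => by
        rw [Finset.mul_sum]
        exact Finset.sum_congr rfl fun i _ => by field_simp
      have hw' : ∀ i ∈ s, 0 ≤ w i / r := fun i hi => div_nonneg (hws i hi) hr0.le
      have hsum' : ∑ i ∈ s, w i / r = 1 := by rw [← Finset.sum_div, ← hrdef, div_self hr]
      have h1 := (ih _ hw' hsum').2 hfs hgs ha hb hab
      have hmem : ∀ h : ι → ℝ, (∀ i ∈ s, h i ∈ F.D) → ∑ i ∈ s, w i / r * h i ∈ F.D :=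
        fun h hh => F.convex_dom.sum_mem hw' hsum' hh
      have h2 := (F.joint_convex (w j) ⟨hwj, by linarith⟩).2
        (x := (f j, ∑ i ∈ s, w i / r * f i)) ⟨hfj, hmem f hfs⟩
        (y := (g j, ∑ i ∈ s, w i / r * g i)) ⟨hgj, hmem g hgs⟩ ha hb hab
      have hlin : ∑ i ∈ s, w i / r * (a * f i + b * g i) =
          a * ∑ i ∈ s, w i / r * f i + b * ∑ i ∈ s, w i / r * g i := by
        rw [Finset.mul_sum, Finset.mul_sum, ← Finset.sum_add_distrib]
        exact Finset.sum_congr rfl fun i _ => by ring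
      have hrj : 1 - w j = r := by linarith
      simp only [Pi.add_apply, Pi.smul_apply, smul_eq_mul, Prod.smul_mk, Prod.mk_add_mk, hrj,
        hlin] at h1 h2
      rw [hscale (fun i => F.Φ (a * f i + b * g i)), hscale (fun i => a * f i + b * g i),
        hscale (fun i => F.Φ (f i)), hscale f, hscale (fun i => F.Φ (g i)), hscale g, hlin]
      have h3 := mul_le_mul_of_nonneg_left h1 hr0.le
      linarith

theorem ClassF.convexOn_Hphi (F : ClassF) {Ω : Type*} [Fintype Ω] {p : Ω → ℝ} (hp : IsPMF p) :
    ConvexOn ℝ {f : Ω → ℝ | ∀ ω, p ω ≠ 0 → f ω ∈ F.D} (Hphi F.Φ p) := by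
  classical
  have hsupp : ∀ h : Ω → ℝ, ∑ ω ∈ Finset.univ.filter (fun ω => p ω ≠ 0), p ω * h ω =
      ∑ ω, p ω * h ω := fun h =>
    Finset.sum_filter_of_ne fun ω _ hω hp0 => hω (by rw [hp0, zero_mul])
  have h := F.convexOn_entropy (Finset.univ.filter fun ω => p ω ≠ 0) p (fun i _ => hp.1 i)
    (by simpa [hp.2] using hsupp fun _ => 1)
  have hfun : (fun f : Ω → ℝ => ∑ i ∈ Finset.univ.filter (fun ω => p ω ≠ 0), p i * F.Φ (f i) -
      F.Φ (∑ i ∈ Finset.univ.filter (fun ω => p ω ≠ 0), p i * f i)) = Hphi F.Φ p := by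
    funext f
    rw [hsupp f, hsupp fun i => F.Φ (f i)]
    rfl
  rw [hfun] at h
  simpa using h

/-- Subadditivity of the `Φ`-entropy of an averaged function under a product kernel. -/
theorem ClassF.Hphi_prod_kernel_le (F : ClassF) {A B : Type*} [Fintype A] [Fintype B]
    {p : A → ℝ} {q : B → ℝ} (hp : IsPMF p) (hq : IsPMF q) {K : A → A → ℝ} {L : B → B → ℝ}
    (hK : IsStationaryKernel p K) (hL : IsStationaryKernel q L)
    {f : A × B → ℝ} (hf : ∀ z, f z ∈ F.D) :
    Hphi F.Φ (fun z : A × B => p z.1 * q z.2)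
        (fun z => ∑ y', L z.2 y' * ∑ x', K z.1 x' * f (x', y')) ≤
      expect q (fun y => Hphi F.Φ p fun x => ∑ x', K x x' * f (x', y)) +
        Hphi F.Φ q (fun y => ∑ y', L y y' * expect p fun x => f (x, y')) := by
  have hmarg : ∀ y, (expect p fun x => ∑ y', L y y' * ∑ x', K x x' * f (x', y')) =
      ∑ y', L y y' * expect p fun x => f (x, y') := fun y => by
    have hinv : ∀ y', ∑ x, p x * ∑ x', K x x' * f (x', y') = ∑ x', p x' * f (x', y') := fun y' => by
      simp only [Finset.mul_sum]
      rw [Finset.sum_comm]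
      refine Finset.sum_congr rfl fun x' _ => ?_
      rw [← hK.stationary x', Finset.sum_mul]
      exact Finset.sum_congr rfl fun x _ => by ring
    simp only [_root_.expect, ← hinv]
    simp only [Finset.mul_sum]
    rw [Finset.sum_comm]
    exact Finset.sum_congr rfl fun y' _ => Finset.sum_congr rfl fun x _ =>
      Finset.sum_congr rfl fun x' _ => by ring
  rw [Hphi_prod]
  simp only [hmarg]
  refine add_le_add_left ?_ _
  have hjensen : ∀ y, q y ≠ 0 →
      (Hphi F.Φ p fun x => ∑ y', L y y' * ∑ x', K x x' * f (x', y')) ≤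
        ∑ y', L y y' * Hphi F.Φ p fun x => ∑ x', K x x' * f (x', y') := fun y hy => by
    have h := (F.convexOn_Hphi hp).map_sum_le (t := Finset.univ) (w := L y)
      (p := fun y' x => ∑ x', K x x' * f (x', y')) (fun y' _ => hL.nonneg y y')
      (hL.sum_eq_one y hy)
      (fun y' _ x hx => F.convex_dom.sum_mem (fun x' _ => hK.nonneg x x') (hK.sum_eq_one x hx)
        fun x' _ => hf _)
    simpa only [Finset.sum_fn, Pi.smul_apply, smul_eq_mul, Pi.smul_def] using h
  calc expect q (fun y => Hphi F.Φ p fun x => ∑ y', L y y' * ∑ x', K x x' * f (x', y'))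
      ≤ ∑ y, q y * ∑ y', L y y' * Hphi F.Φ p fun x => ∑ x', K x x' * f (x', y') :=
        Finset.sum_le_sum fun y _ => by
          by_cases hy : q y = 0
          · simp [hy]
          · exact mul_le_mul_of_nonneg_left (hjensen y hy) (hq.1 y)
    _ = expect q (fun y => Hphi F.Φ p fun x => ∑ x', K x x' * f (x', y)) := by
        simp only [Finset.mul_sum, _root_.expect]
        rw [Finset.sum_comm]
        refine Finset.sum_congr rfl fun y' _ => ?_
        rw [← hL.stationary y', Finset.sum_mul]
        exact Finset.sum_congr rfl fun y _ => by ring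

theorem condExp_coord_prod {ι : Type*} [Fintype ι] [DecidableEq ι] {α β : ι → Type*}
    [∀ i, Fintype (α i)] [∀ i, Fintype (β i)]
    (p : (∀ i, α i) → ℝ) (q : (∀ i, β i) → ℝ) (f : (∀ i, α i) × (∀ i, β i) → ℝ) (i : ι)
    (z : ∀ i, α i × β i) :
    condExp (fun z : ∀ i, α i × β i => p (fun i => (z i).1) * q (fun i => (z i).2))
        (fun z => f (Equiv.arrowProdEquivProdArrow _ α β z)) (fun z => z i) z =
      ∑ y', condKernel q (fun y => y i) (Equiv.arrowProdEquivProdArrow _ α β z).2 y' *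
        ∑ x', condKernel p (fun x => x i) (Equiv.arrowProdEquivProdArrow _ α β z).1 x' * f (x', y') := by
  classical
  have hsplit : ∀ g : (∀ i, α i × β i) → ℝ,
      ∑ z, g z = ∑ y : ∀ i, β i, ∑ x : ∀ i, α i, g fun i => (x i, y i) := fun g => by
    rw [← (Equiv.arrowProdEquivProdArrow _ α β).symm.sum_comp g, Fintype.sum_prod_type_right]
    rfl
  have hite : ∀ (x : ∀ i, α i) (y : ∀ i, β i) (c : ℝ),
      (if (x i, y i) = z i then p x * q y * c else 0) =
        (if y i = (z i).2 then q y else 0) * ((if x i = (z i).1 then p x else 0) * c) :=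
    fun x y c => by
      by_cases hx : x i = (z i).1 <;> by_cases hy : y i = (z i).2 <;>
        simp [Prod.ext_iff, hx, hy, mul_comm, mul_left_comm]
  have hite' : ∀ (x : ∀ i, α i) (y : ∀ i, β i), (if (x i, y i) = z i then p x * q y else 0) =
        (if y i = (z i).2 then q y else 0) * (if x i = (z i).1 then p x else 0) :=
    fun x y => by simpa using hite x y 1
  simp only [condExp, condKernel, hsplit]
  simp only [Equiv.arrowProdEquivProdArrow, Equiv.coe_fn_mk, hite, hite', ← Finset.mul_sum, ← Finset.sum_mul,
    div_mul_eq_mul_div, ← Finset.sum_div, ← mul_div_assoc]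
  rw [div_div]
  rfl

theorem Hphi_condExp_coord_prod {ι : Type*} [Fintype ι] [DecidableEq ι] {α β : ι → Type*}
    [∀ i, Fintype (α i)] [∀ i, Fintype (β i)] (Φ : ℝ → ℝ)
    (p : (∀ i, α i) → ℝ) (q : (∀ i, β i) → ℝ) (f : (∀ i, α i) × (∀ i, β i) → ℝ) (i : ι) :
    Hphi Φ (fun z : ∀ i, α i × β i => p (fun i => (z i).1) * q (fun i => (z i).2))
        (condExp (fun z : ∀ i, α i × β i => p (fun i => (z i).1) * q (fun i => (z i).2))
          (fun z => f (Equiv.arrowProdEquivProdArrow _ α β z)) (fun z => z i)) =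
      Hphi Φ (fun z : (∀ i, α i) × (∀ i, β i) => p z.1 * q z.2)
        (fun z => ∑ y', condKernel q (fun y => y i) z.2 y' *
          ∑ x', condKernel p (fun x => x i) z.1 x' * f (x', y')) := by
  rw [← Hphi_comp_equiv Φ (Equiv.arrowProdEquivProdArrow _ α β)]
  congr 1
  funext z
  exact condExp_coord_prod p q f i z

theorem mem_ribbon_prod_iff {k : ℕ} {α β : Fin k → Type} [∀ i, Fintype (α i)]
    [∀ i, Fintype (β i)] (Φ : ℝ → ℝ) (D : Set ℝ)
    (p : (∀ i, α i) → ℝ) (q : (∀ i, β i) → ℝ) (l : Fin k → ℝ) :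
    l ∈ ribbon Φ D (fun z : ∀ i, α i × β i => p (fun i => (z i).1) * q (fun i => (z i).2)) ↔
      (∀ i, 0 ≤ l i) ∧ ∀ f : (∀ i, α i) × (∀ i, β i) → ℝ, (∀ z, f z ∈ D) →
        ∑ i, l i * Hphi Φ (fun z : (∀ i, α i) × (∀ i, β i) => p z.1 * q z.2)
          (fun z => ∑ y', condKernel q (fun y => y i) z.2 y' *
            ∑ x', condKernel p (fun x => x i) z.1 x' * f (x', y')) ≤
          Hphi Φ (fun z : (∀ i, α i) × (∀ i, β i) => p z.1 * q z.2) f := by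
  refine and_congr_right fun _ => ⟨fun h f hf => ?_, fun h f hf => ?_⟩
  · have h1 := h (fun z => f (Equiv.arrowProdEquivProdArrow _ α β z)) fun z => hf _
    simp only [Hphi_condExp_coord_prod] at h1
    rw [← Hphi_comp_equiv Φ (Equiv.arrowProdEquivProdArrow _ α β) _ f]
    exact h1
  · have h1 := h (fun w => f ((Equiv.arrowProdEquivProdArrow _ α β).symm w)) fun z => hf _
    refine ge_iff_le.2 <| (Finset.sum_congr rfl fun i _ => congrArg (l i * ·)
      (Hphi_condExp_coord_prod Φ p q
        (fun w => f ((Equiv.arrowProdEquivProdArrow _ α β).symm w)) i)).trans_le (h1.trans_eq ?_)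
    rw [← Hphi_comp_equiv Φ (Equiv.arrowProdEquivProdArrow _ α β)]
    rfl

theorem mem_ribbon_iff {k : ℕ} {α : Fin k → Type} [∀ i, Fintype (α i)]
    (Φ : ℝ → ℝ) (D : Set ℝ) (p : (∀ i, α i) → ℝ) (l : Fin k → ℝ) :
    l ∈ ribbon Φ D p ↔ (∀ i, 0 ≤ l i) ∧ ∀ f : (∀ i, α i) → ℝ, (∀ x, f x ∈ D) →
      ∑ i, l i * Hphi Φ p (fun x => ∑ x', condKernel p (fun x => x i) x x' * f x') ≤
        Hphi Φ p f := by
  simp only [← condExp_eq_sum_condKernel]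
  rfl

/-- Tensorization of Φ-ribbons: if `(X_1, …, X_k)` (joint pmf `pX`) is
independent of `(Y_1, …, Y_k)` (joint pmf `pY`), then the Φ-ribbon of the pairs
`((X_1,Y_1), …, (X_k,Y_k))` equals `𝓡_Φ(X_1,…,X_k) ∩ 𝓡_Φ(Y_1,…,Y_k)`. -/
theorem ribbon_tensorization
    {k : ℕ} {α β : Fin k → Type} [∀ i, Fintype (α i)] [∀ i, Fintype (β i)]
    (pX : (∀ i, α i) → ℝ) (hpX : IsPMF pX)
    (pY : (∀ i, β i) → ℝ) (hpY : IsPMF pY)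
    (F : ClassF) :
    ribbon F.Φ F.D
        (fun z : ∀ i, α i × β i => pX (fun i => (z i).1) * pY (fun i => (z i).2))
      = ribbon F.Φ F.D pX ∩ ribbon F.Φ F.D pY := by
  ext l
  rw [Set.mem_inter_iff, mem_ribbon_prod_iff, mem_ribbon_iff, mem_ribbon_iff]
  have hK := fun i => isStationaryKernel_condKernel hpX.1 fun x : ∀ i, α i => x i
  have hL := fun i => isStationaryKernel_condKernel hpY.1 fun y : ∀ i, β i => y i
  constructor
  · rintro ⟨hl, h⟩
    refine ⟨⟨hl, fun u hu => ?_⟩, ⟨hl, fun v hv => ?_⟩⟩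
    · have h1 := h (fun z => u z.1) fun z => hu _
      rw [Hphi_prod_fst F.Φ hpY.2] at h1
      convert h1 using 3 with i
      rw [← Hphi_prod_fst F.Φ hpY.2]
      refine Hphi_congr _ fun z hz => ?_
      dsimp only
      rw [← Finset.sum_mul, (hL i).sum_eq_one _ (right_ne_zero_of_mul hz), one_mul]
    · have h1 := h (fun z => v z.2) fun z => hv _
      rw [Hphi_prod_snd F.Φ hpX.2] at h1
      convert h1 using 3 with i
      rw [← Hphi_prod_snd F.Φ hpX.2]
      refine Hphi_congr _ fun z hz => ?_
      simp only [← Finset.sum_mul, (hK i).sum_eq_one _ (left_ne_zero_of_mul hz), one_mul]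
  · rintro ⟨⟨hl, hX⟩, ⟨-, hY⟩⟩
    refine ⟨hl, fun f hf => ?_⟩
    have h1 := fun y => hX (fun x => f (x, y)) fun x => hf _
    have h2 := hY (fun y => expect pX fun x => f (x, y)) fun y =>
      F.convex_dom.sum_mem (fun x _ => hpX.1 x) hpX.2 fun x _ => hf _
    rw [Hphi_prod]
    refine (Finset.sum_le_sum fun i _ => mul_le_mul_of_nonneg_left
      (F.Hphi_prod_kernel_le hpX hpY (hK i) (hL i) hf) (hl i)).trans ?_
    simp only [mul_add, Finset.sum_add_distrib]
    refine add_le_add (le_trans (le_of_eq ?_)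
      (Finset.sum_le_sum fun y _ => mul_le_mul_of_nonneg_left (h1 y) (hpY.1 y))) h2
    simp only [_root_.expect, Finset.mul_sum]
    rw [Finset.sum_comm]
    exact Finset.sum_congr rfl fun y _ => Finset.sum_congr rfl fun i _ => by ring

end
end

section
/- For every function Φ in the class 𝓕 and all jointly distributed random variables (X, Y) taking values in finite sets, the Φ-strong data processing inequality constant satisfies η_Φ(X, Y) ≥ ρ(X, Y)², where ρ(X, Y) is the maximal correlation. -/
open Finset

noncomputable section

/-- The Φ-SDPI constant `η_Φ(X, Y)` of a joint pmf `p` on `α × β`: the infimum of all `λ ≥ 0`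
such that `λ H_Φ(f) ≥ H_Φ(E[f|Y])` for every function `f` of `X` with range in `D`. -/
def etaPhi {α β : Type} [Fintype α] [Fintype β]
    (Φ : ℝ → ℝ) (D : Set ℝ) (p : α × β → ℝ) : ℝ :=
  sInf {l : ℝ | 0 ≤ l ∧ ∀ f : α → ℝ, (∀ x, f x ∈ D) →
    l * Hphi Φ p (fun ω => f ω.1) ≥ Hphi Φ p (condExp p (fun ω => f ω.1) Prod.snd)}
/-- The maximal correlation `ρ(X, Y)` of a joint pmf `p` on `α × β`: the supremum of the
Pearson correlation of `f(X)` and `g(Y)` over all non-constant (non-degenerate) `f`, `g`. -/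
def maxCorr {α β : Type} [Fintype α] [Fintype β] (p : α × β → ℝ) : ℝ :=
  sSup {r : ℝ | ∃ f : α → ℝ, ∃ g : β → ℝ,
    var p (fun ω => f ω.1) ≠ 0 ∧ var p (fun ω => g ω.2) ≠ 0 ∧
    r = expect p (fun ω => (f ω.1 - expect p (fun ω' => f ω'.1)) *
          (g ω.2 - expect p (fun ω' => g ω'.2))) /
        Real.sqrt (var p (fun ω => f ω.1) * var p (fun ω => g ω.2))}
section

open Filter Topology

/-- A smooth convex non-affine function has positive second derivative at some interior point. -/
lemma ClassF.exists_derivWithin_derivWithin_pos (F : ClassF) :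
    ∃ t ∈ interior F.D,
      0 < derivWithin (derivWithin F.Φ (interior F.D)) (interior F.D) t := by
  set U := interior F.D
  have hUo : IsOpen U := isOpen_interior
  have hUc : Convex ℝ U := F.convex_dom.interior
  have hsub : U ⊆ F.D := interior_subset
  have hsm : ContDiffOn ℝ (⊤ : ℕ∞) F.Φ U := F.smooth.mono hsub
  have hdiff : DifferentiableOn ℝ F.Φ U := hsm.differentiableOn (by simp)
  have hdd : DifferentiableOn ℝ (derivWithin F.Φ U) U :=
    ((hsm.derivWithin (m := 1) hUo.uniqueDiffOn (by norm_cast)).differentiableOn (by simp))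
  have hmono : MonotoneOn (derivWithin F.Φ U) U :=
    (F.convexOn.subset hsub hUc).monotoneOn_derivWithin hdiff
  by_contra! hcon
  have hzero : U.EqOn (deriv (derivWithin F.Φ U)) 0 := fun t ht => by
    rw [← derivWithin_of_isOpen hUo ht]
    exact le_antisymm (hcon t ht) hmono.derivWithin_nonneg
  obtain ⟨a, ha⟩ := hUo.exists_is_const_of_deriv_eq_zero hUc.isPreconnected hdd hzero
  have hlin : U.EqOn (deriv F.Φ) (deriv fun x => a * x) := fun t ht => by
    rw [← derivWithin_of_isOpen hUo ht, ha t ht]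
    simp
  obtain ⟨b, hb⟩ := hUo.exists_eq_add_of_deriv_eq hUc.isPreconnected hdiff (by fun_prop) hlin
  have hnt : F.D.Nontrivial := by
    by_contra h
    rw [Set.not_nontrivial_iff] at h
    rcases h.eq_empty_or_singleton with h | ⟨x, h⟩
    · exact F.not_affine ⟨0, 0, by simp [h]⟩
    · exact F.not_affine ⟨0, F.Φ x, by simp [h]⟩
  have hne := F.convex_dom.nontrivial_iff_nonempty_interior.1 hnt
  have hcl : F.D ⊆ closure U := by
    rw [F.convex_dom.closure_interior_eq_closure_of_nonempty_interior hne]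
    exact subset_closure
  exact F.not_affine ⟨a, b, hb.of_subset_closure F.smooth.continuousOn (by fun_prop) hsub hcl⟩

/-- Second-order expansion of a weighted sum of values of `Φ` near an interior point. -/
lemma ClassF.tendsto_sum_sub_div_sq {ι : Type*} [Fintype ι] (F : ClassF) {t : ℝ}
    (ht : t ∈ interior F.D) (w a : ι → ℝ) (hwa : ∑ i, w i * a i = 0) :
    Tendsto (fun ε : ℝ => (∑ i, w i * F.Φ (t + ε * a i) - (∑ i, w i) * F.Φ t) / ε ^ 2) (𝓝[≠] 0)
      (𝓝 (derivWithin (derivWithin F.Φ (interior F.D)) (interior F.D) t / 2 *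
        ∑ i, w i * a i ^ 2)) := by
  set U := interior F.D with hU
  set b := derivWithin F.Φ U t
  set c := derivWithin (derivWithin F.Φ U) U t
  have hUo : IsOpen U := isOpen_interior
  have hT : Tendsto (fun x => ((x - t) ^ 2)⁻¹ *
      (F.Φ x - (F.Φ t + b * (x - t) + c / 2 * (x - t) ^ 2))) (𝓝 t) (𝓝 0) := by
    have h := taylor_tendsto (n := 2) F.convex_dom.interior ht
      ((F.smooth.mono interior_subset).of_le (by norm_cast))
    rw [hUo.nhdsWithin_eq ht] at h
    refine h.congr fun x => ?_
    have h2 : iteratedDerivWithin 2 F.Φ U t = c := by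
      rw [iteratedDerivWithin_succ]
      exact derivWithin_congr (fun x _ => congrFun iteratedDerivWithin_one x)
        (congrFun iteratedDerivWithin_one t)
    simp only [taylorWithinEval_succ, taylor_within_zero_eval, smul_eq_mul, zero_add, ← hU,
      iteratedDerivWithin_one, one_add_one_eq_two, h2]
    norm_num
    left
    ring
  have hi : ∀ i, Tendsto (fun ε : ℝ => (F.Φ (t + ε * a i) - F.Φ t - b * (ε * a i)) / ε ^ 2)
      (𝓝[≠] 0) (𝓝 (c / 2 * a i ^ 2)) := by
    intro i
    have hcomp : Tendsto (fun ε : ℝ => t + ε * a i) (𝓝[≠] 0) (𝓝 t) := by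
      have : Tendsto (fun ε : ℝ => t + ε * a i) (𝓝 0) (𝓝 (t + 0 * a i)) :=
        Continuous.tendsto (by fun_prop) 0
      rw [zero_mul, add_zero] at this
      exact this.mono_left nhdsWithin_le_nhds
    have h := ((hT.comp hcomp).const_mul (a i ^ 2)).add_const (c / 2 * a i ^ 2)
    rw [mul_zero, zero_add] at h
    refine h.congr' ?_
    filter_upwards [self_mem_nhdsWithin] with ε hε
    have hε : ε ≠ 0 := hε
    by_cases ha : a i = 0
    · simp [ha]
    · simp only [Function.comp, add_sub_cancel_left]
      field_simp
      ring
  have hs := tendsto_finsetSum univ fun i _ => (hi i).const_mul (w i)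
  have hlim : ∑ i, w i * (c / 2 * a i ^ 2) = c / 2 * ∑ i, w i * a i ^ 2 := by
    rw [mul_sum]
    exact sum_congr rfl fun i _ => by ring
  rw [hlim] at hs
  refine hs.congr fun ε => ?_
  have hb : ∑ i, w i * (b * (ε * a i)) = 0 := by
    rw [← mul_zero (b * ε), ← hwa, mul_sum]
    exact sum_congr rfl fun i _ => by ring
  simp only [mul_div_assoc', ← sum_div, mul_sub, sum_sub_distrib, hb, sub_zero, sum_mul]

variable {α β : Type} [Fintype α] [Fintype β]

lemma expect_snd (p : α × β → ℝ) (G : β → ℝ) :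
    _root_.expect p (fun ω => G ω.2) = ∑ y, (∑ x, p (x, y)) * G y := by
  simp [_root_.expect, Fintype.sum_prod_type_right, sum_mul]

lemma condExp_snd (p : α × β → ℝ) (f : α → ℝ) (ω : α × β) :
    condExp p (fun ω => f ω.1) Prod.snd ω =
      (∑ x, p (x, ω.2) * f x) / ∑ x, p (x, ω.2) := by
  classical
  simp only [condExp, Fintype.sum_prod_type]
  congr 1 <;> exact sum_congr rfl fun x _ => by simp

lemma IsPMF.sum_fiber_mul_div {p : α × β → ℝ} (hp : IsPMF p) (f : α → ℝ) (y : β) :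
    (∑ x, p (x, y)) * ((∑ x, p (x, y) * f x) / ∑ x, p (x, y)) = ∑ x, p (x, y) * f x := by
  by_cases h : ∑ x, p (x, y) = 0
  · have h0 := (sum_eq_zero_iff_of_nonneg fun x _ => hp.1 (x, y)).1 h
    rw [h, zero_mul, sum_eq_zero fun x hx => by rw [h0 x hx, zero_mul]]
  · exact mul_div_cancel₀ _ h

lemma IsPMF.expect_condExp {p : α × β → ℝ} (hp : IsPMF p) (f : α → ℝ) :
    _root_.expect p (condExp p (fun ω => f ω.1) Prod.snd) =
      _root_.expect p (fun ω => f ω.1) := by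
  have h : condExp p (fun ω => f ω.1) Prod.snd =
      fun ω => (fun y => (∑ x, p (x, y) * f x) / ∑ x, p (x, y)) ω.2 :=
    funext fun ω => condExp_snd p f ω
  rw [h, expect_snd p fun y => (∑ x, p (x, y) * f x) / ∑ x, p (x, y)]
  simp only [hp.sum_fiber_mul_div]
  simp [_root_.expect, Fintype.sum_prod_type_right]

/-- The data processing inequality for the Φ-entropy. -/
lemma IsPMF.Hphi_condExp_le {p : α × β → ℝ} (hp : IsPMF p) {Φ : ℝ → ℝ} {D : Set ℝ}
    (hΦ : ConvexOn ℝ D Φ) {f : α → ℝ} (hf : ∀ x, f x ∈ D) :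
    Hphi Φ p (condExp p (fun ω => f ω.1) Prod.snd) ≤ Hphi Φ p (fun ω => f ω.1) := by
  rw [Hphi, Hphi, hp.expect_condExp]
  refine sub_le_sub_right ?_ _
  simp only [condExp_snd]
  rw [expect_snd p fun y => Φ ((∑ x, p (x, y) * f x) / ∑ x, p (x, y)), _root_.expect,
    Fintype.sum_prod_type_right]
  refine sum_le_sum fun y _ => ?_
  have hnn : ∀ x ∈ univ, 0 ≤ p (x, y) := fun x _ => hp.1 _
  rcases (sum_nonneg hnn).eq_or_lt with h | h
  · rw [← h, zero_mul, sum_eq_zero fun x hx => by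
      rw [(sum_eq_zero_iff_of_nonneg hnn).1 h.symm x hx, zero_mul]]
  · have hJ := hΦ.map_centerMass_le hnn h fun x _ => hf x
    simp only [centerMass, smul_eq_mul, Function.comp, inv_mul_eq_div] at hJ
    rwa [le_div_iff₀' h] at hJ

/-- An admissible SDPI constant for `Φ` is admissible for the variance of centered functions. -/
lemma ClassF.sum_condMean_sq_le (F : ClassF) {p : α × β → ℝ} (hp : IsPMF p) {l : ℝ}
    (hl : ∀ f : α → ℝ, (∀ x, f x ∈ F.D) →
      l * Hphi F.Φ p (fun ω => f ω.1) ≥ Hphi F.Φ p (condExp p (fun ω => f ω.1) Prod.snd))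
    (h : α → ℝ) (hh : ∑ ω, p ω * h ω.1 = 0) :
    ∑ y, (∑ x, p (x, y)) * ((∑ x, p (x, y) * h x) / ∑ x, p (x, y)) ^ 2 ≤
      l * ∑ ω, p ω * h ω.1 ^ 2 := by
  obtain ⟨t, ht, hc⟩ := F.exists_derivWithin_derivWithin_pos
  set c := derivWithin (derivWithin F.Φ (interior F.D)) (interior F.D) t
  set m : β → ℝ := fun y => ∑ x, p (x, y) with hm
  set k : β → ℝ := fun y => (∑ x, p (x, y) * h x) / ∑ x, p (x, y) with hk
  have hmk : ∑ y, m y * k y = 0 := by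
    simp only [hm, hk, hp.sum_fiber_mul_div]
    rw [← hh, Fintype.sum_prod_type_right]
  have hm1 : ∑ y, m y = 1 := by rw [← hp.2, Fintype.sum_prod_type_right]
  have hX := (F.tendsto_sum_sub_div_sq ht p (fun ω => h ω.1) hh).const_mul l
  have hY := F.tendsto_sum_sub_div_sq ht m k hmk
  have hmem : ∀ᶠ ε : ℝ in 𝓝[≠] 0, ∀ x, t + ε * h x ∈ F.D := by
    refine eventually_all.2 fun x => Tendsto.eventually_mem ?_ (mem_interior_iff_mem_nhds.1 ht)
    have : Tendsto (fun ε : ℝ => t + ε * h x) (𝓝 0) (𝓝 (t + 0 * h x)) :=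
      Continuous.tendsto (by fun_prop) 0
    rw [zero_mul, add_zero] at this
    exact this.mono_left nhdsWithin_le_nhds
  have hle := le_of_tendsto_of_tendsto hY hX <| by
    filter_upwards [hmem] with ε hε
    have hmain := hl (fun x => t + ε * h x) hε
    have hE : _root_.expect p (fun ω => t + ε * h ω.1) = t := by
      have : ∀ ω, p ω * (t + ε * h ω.1) = p ω * t + ε * (p ω * h ω.1) := fun ω => by ring
      simp only [_root_.expect, this, sum_add_distrib, ← sum_mul, ← mul_sum, hh, hp.2]
      ring
    rw [Hphi, Hphi, hp.expect_condExp fun x => t + ε * h x, hE] at hmain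
    simp only [condExp_snd p fun x => t + ε * h x] at hmain
    rw [expect_snd p fun y => F.Φ ((∑ x, p (x, y) * (t + ε * h x)) / ∑ x, p (x, y))] at hmain
    have hcond : ∀ y, (∑ x, p (x, y)) *
        F.Φ ((∑ x, p (x, y) * (t + ε * h x)) / ∑ x, p (x, y)) = m y * F.Φ (t + ε * k y) := by
      intro y
      by_cases h0 : ∑ x, p (x, y) = 0
      · simp [hm, h0]
      · congr 2
        have : ∀ x, p (x, y) * (t + ε * h x) = p (x, y) * t + ε * (p (x, y) * h x) :=
          fun x => by ring
        simp only [this, sum_add_distrib, ← sum_mul, ← mul_sum, hk]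
        field_simp
    simp only [hcond, _root_.expect] at hmain
    rw [hm1, hp.2, one_mul, mul_div_assoc']
    exact div_le_div_of_nonneg_right hmain (sq_nonneg ε)
  rw [mul_left_comm] at hle
  exact le_of_mul_le_mul_left hle (by positivity)

lemma IsPMF.var_nonneg {Ω : Type*} [Fintype Ω] {p : Ω → ℝ} (hp : IsPMF p) (f : Ω → ℝ) :
    0 ≤ var p f :=
  sum_nonneg fun ω _ => mul_nonneg (hp.1 ω) (sq_nonneg _)

/-- An admissible SDPI constant for `Φ` bounds the squared Pearson correlation. -/
lemma ClassF.sq_cov_le (F : ClassF) {p : α × β → ℝ} (hp : IsPMF p) {l : ℝ}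
    (hl : ∀ f : α → ℝ, (∀ x, f x ∈ F.D) →
      l * Hphi F.Φ p (fun ω => f ω.1) ≥ Hphi F.Φ p (condExp p (fun ω => f ω.1) Prod.snd))
    (f : α → ℝ) (g : β → ℝ) :
    _root_.expect p (fun ω => (f ω.1 - _root_.expect p (fun ω' => f ω'.1)) *
      (g ω.2 - _root_.expect p (fun ω' => g ω'.2))) ^ 2 ≤
      l * (var p (fun ω => f ω.1) * var p (fun ω => g ω.2)) := by
  set a := _root_.expect p (fun ω' => f ω'.1) with ha
  set b := _root_.expect p (fun ω' => g ω'.2) with hb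
  have hh : ∑ ω, p ω * (fun x => f x - a) ω.1 = 0 := by
    simp only [mul_sub, sum_sub_distrib, ← sum_mul, hp.2, ha, _root_.expect]
    ring
  have hle := F.sum_condMean_sq_le hp hl (fun x => f x - a) hh
  set m : β → ℝ := fun y => ∑ x, p (x, y) with hm
  set k : β → ℝ := fun y => (∑ x, p (x, y) * (f x - a)) / ∑ x, p (x, y) with hk
  have hm0 : ∀ y, 0 ≤ m y := fun y => sum_nonneg fun x _ => hp.1 _
  have hcov : _root_.expect p (fun ω => (f ω.1 - a) * (g ω.2 - b)) =
      ∑ y, m y * k y * (g y - b) := by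
    simp only [hm, hk, hp.sum_fiber_mul_div]
    rw [_root_.expect, Fintype.sum_prod_type_right]
    exact sum_congr rfl fun y _ => by rw [sum_mul]; exact sum_congr rfl fun x _ => by ring
  have hvar : var p (fun ω => g ω.2) = ∑ y, m y * (g y - b) ^ 2 :=
    expect_snd p fun y => (g y - b) ^ 2
  calc _ = (∑ y, m y * k y * (g y - b)) ^ 2 := by rw [hcov]
    _ ≤ (∑ y, m y * k y ^ 2) * ∑ y, m y * (g y - b) ^ 2 :=
      sum_sq_le_sum_mul_sum_of_sq_le_mul _ (fun y _ => mul_nonneg (hm0 y) (sq_nonneg _))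
        (fun y _ => mul_nonneg (hm0 y) (sq_nonneg _)) fun y _ => le_of_eq (by ring)
    _ ≤ (l * var p (fun ω => f ω.1)) * var p (fun ω => g ω.2) := by
      rw [hvar]
      exact mul_le_mul_of_nonneg_right hle
        (sum_nonneg fun y _ => mul_nonneg (hm0 y) (sq_nonneg _))
    _ = _ := mul_assoc _ _ _

end

/-- For every `Φ ∈ 𝓕` and every joint pmf `p` of `(X, Y)`,
`η_Φ(X, Y) ≥ ρ(X, Y)²`. -/
theorem etaPhi_ge_sq_maxCorr
    {α β : Type} [Fintype α] [Fintype β]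
    (p : α × β → ℝ) (hp : IsPMF p) (F : ClassF) :
    etaPhi F.Φ F.D p ≥ maxCorr p ^ 2 := by
  refine le_csInf ⟨1, zero_le_one, fun f hf => ?_⟩ ?_
  · rw [one_mul]
    exact hp.Hphi_condExp_le F.convexOn hf
  rintro l ⟨hl0, hl⟩
  rw [maxCorr]
  set S := {r : ℝ | ∃ f : α → ℝ, ∃ g : β → ℝ,
    var p (fun ω => f ω.1) ≠ 0 ∧ var p (fun ω => g ω.2) ≠ 0 ∧
    r = expect p (fun ω => (f ω.1 - expect p (fun ω' => f ω'.1)) *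
          (g ω.2 - expect p (fun ω' => g ω'.2))) /
        Real.sqrt (var p (fun ω => f ω.1) * var p (fun ω => g ω.2))}
  have hr : ∀ r ∈ S, |r| ≤ √l := by
    rintro r ⟨f, g, hf, hg, rfl⟩
    have hpos : 0 < var p (fun ω => f ω.1) * var p (fun ω => g ω.2) :=
      mul_pos ((hp.var_nonneg _).lt_of_ne' hf) ((hp.var_nonneg _).lt_of_ne' hg)
    refine Real.abs_le_sqrt ?_
    rw [div_pow, Real.sq_sqrt hpos.le, div_le_iff₀ hpos]
    exact F.sq_cov_le hp hl f g
  rcases S.eq_empty_or_nonempty with h | ⟨r, hrS⟩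
  · rw [h, Real.sSup_empty]
    simpa using hl0
  · have hup : sSup S ≤ √l := csSup_le ⟨r, hrS⟩ fun r hr' => (abs_le.1 (hr r hr')).2
    have hlow : -√l ≤ sSup S := (abs_le.1 (hr r hrS)).1.trans
      (le_csSup ⟨√l, fun r hr' => (abs_le.1 (hr r hr')).2⟩ hrS)
    rw [← Real.sq_sqrt hl0]
    exact sq_le_sq' hlow hup

end
end
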